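/- There exists a constant β > 0 such that the following holds. For every finite simple connected undirected graph G with n ≥ 2 vertices and m edges in which every vertex has degree at least 1, for every pair of vertices x, y and every natural number t with t ≤ β·m², the number of visits to y by the lazy simple random walk of length t started at x satisfies Pr(N_t^x(y) ≥ 24·d(y)·√(t+1)·log₂ n) ≤ 1/n². -/

import Mathlib

open Finset

section Defs

variable {V : Type} [Fintype V] [DecidableEq V]

/-- Transition kernel of the lazy simple random walk on `G`. -/
noncomputable def lazyStep (G : SimpleGraph V) [DecidableRel G.Adj] (u v : V) : ℝ :=
  if u = v then 1 / 2 else if G.Adj u v then 1 / (2 * (G.degree u : ℝ)) else 0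

/-- Law (probability mass function) of the lazy random walk of length `t` started at `x`,
as a function on trajectories `Fin (t+1) → V`. -/
noncomputable def lazyWalkLaw (G : SimpleGraph V) [DecidableRel G.Adj] (x : V) (t : ℕ)
    (f : Fin (t + 1) → V) : ℝ :=
  (if f 0 = x then 1 else 0) * ∏ i : Fin t, lazyStep G (f i.castSucc) (f i.succ)

/-- Probability of an event `E` of trajectories, under the lazy walk law. -/
noncomputable def lazyWalkPr (G : SimpleGraph V) [DecidableRel G.Adj] (x : V) (t : ℕ)
    (E : Set (Fin (t + 1) → V)) : ℝ :=
  ∑ f : Fin (t + 1) → V, E.indicator (lazyWalkLaw G x t) f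

/-- Expectation of a random variable `N` of the trajectory, under the lazy walk law. -/
noncomputable def lazyWalkExp (G : SimpleGraph V) [DecidableRel G.Adj] (x : V) (t : ℕ)
    (N : (Fin (t + 1) → V) → ℝ) : ℝ :=
  ∑ f : Fin (t + 1) → V, lazyWalkLaw G x t f * N f

/-- Number of indices `0 ≤ i ≤ t` at which the trajectory `f` visits `y`. -/
def visits (y : V) {t : ℕ} (f : Fin (t + 1) → V) : ℕ :=
  (Finset.univ.filter fun i => f i = y).card

end Defs


section Helpers

variable {V : Type} [Fintype V] [DecidableEq V] (G : SimpleGraph V) [DecidableRel G.Adj]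

lemma lazyStep_nonneg (u v : V) : 0 ≤ lazyStep G u v := by
  unfold lazyStep
  split_ifs <;> positivity

lemma sum_adj_one (u : V) : ∑ v, (if G.Adj u v then (1 : ℝ) else 0) = G.degree u := by
  rw [Finset.sum_boole, ← SimpleGraph.card_neighborFinset_eq_degree,
    SimpleGraph.neighborFinset_eq_filter]

lemma lazyStep_eq (u v : V) : lazyStep G u v =
    (if u = v then 1 / 2 else 0) +
      1 / (2 * (G.degree u : ℝ)) * (if G.Adj u v then (1 : ℝ) else 0) := by
  unfold lazyStep
  by_cases h : u = v
  · subst h; simp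
  · simp [h]

lemma sum_lazyStep (u : V) (hd : 1 ≤ G.degree u) : ∑ v, lazyStep G u v = 1 := by
  have h0 : (0 : ℝ) < G.degree u := by exact_mod_cast hd
  simp_rw [lazyStep_eq]
  rw [Finset.sum_add_distrib, ← Finset.mul_sum, sum_adj_one]
  simp
  field_simp
  norm_num

lemma degree_mul_step (u : V) (hd : 1 ≤ G.degree u) (f : V → ℝ) :
    (G.degree u : ℝ) * ∑ v, lazyStep G u v * f v =
      (G.degree u : ℝ) * f u / 2 + (1 / 2) * ∑ v, (if G.Adj u v then f v else 0) := by
  have h0 : (0 : ℝ) < G.degree u := by exact_mod_cast hd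
  have : ∑ v, lazyStep G u v * f v =
      f u / 2 + 1 / (2 * (G.degree u : ℝ)) * ∑ v, (if G.Adj u v then f v else 0) := by
    simp_rw [lazyStep_eq, add_mul]
    rw [Finset.sum_add_distrib, Finset.mul_sum]
    congr 1
    · simp; ring
    · apply Finset.sum_congr rfl
      intro v _
      split_ifs <;> simp
  rw [this]
  field_simp

/-- The averaging operator. -/
noncomputable def avg (f : V → ℝ) (u : V) : ℝ := ∑ v, lazyStep G u v * f v

lemma avg_mono {f g : V → ℝ} (h : ∀ v, f v ≤ g v) (u : V) : avg G f u ≤ avg G g u :=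
  Finset.sum_le_sum fun v _ => mul_le_mul_of_nonneg_left (h v) (lazyStep_nonneg G u v)

lemma avg_affine (hd : ∀ v, 1 ≤ G.degree v) (a b : ℝ) (f : V → ℝ) (u : V) :
    avg G (fun v => a + b * f v) u = a + b * avg G f u := by
  unfold avg
  simp_rw [mul_add]
  rw [Finset.sum_add_distrib, ← Finset.sum_mul, sum_lazyStep G u (hd u), Finset.mul_sum]
  congr 1
  · ring
  · exact Finset.sum_congr rfl fun v _ => by ring

lemma min_principle [Nonempty V] (hd : ∀ v, 1 ≤ G.degree v) {q : ℝ} (hq0 : 0 ≤ q) (hq : q < 1)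
    (f : V → ℝ) (h : ∀ x, 0 ≤ f x - q * avg G f x) : ∀ x, 0 ≤ f x := by
  obtain ⟨z, hz⟩ := Finite.exists_min f
  have h1 : f z ≤ avg G f z := by
    have := avg_mono G (f := fun v => f z + 0 * f v) (g := f) (by simpa using hz) z
    rw [avg_affine G hd] at this
    linarith
  have h2 := h z
  have : 0 ≤ f z := by nlinarith
  intro x
  exact this.trans (hz x)

lemma exists_green [Nonempty V] (hd : ∀ v, 1 ≤ G.degree v) {q : ℝ} (hq0 : 0 ≤ q) (hq : q < 1)
    (y : V) : ∃ f : V → ℝ, (∀ x, f x - q * avg G f x = if x = y then 1 else 0) := by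
  let L : (V → ℝ) →ₗ[ℝ] (V → ℝ) :=
    { toFun := fun f x => f x - q * avg G f x
      map_add' := by
        intro f g
        ext x
        simp only [avg, Pi.add_apply, mul_add, Finset.sum_add_distrib]
        ring
      map_smul' := by
        intro c f
        ext x
        simp only [avg, Pi.smul_apply, smul_eq_mul, RingHom.id_apply, mul_sub]
        congr 1
        rw [Finset.mul_sum, Finset.mul_sum, Finset.mul_sum]
        exact Finset.sum_congr rfl fun v _ => by ring }
  have hinj : Function.Injective L := by
    rw [injective_iff_map_eq_zero]
    intro f hf
    have h1 : ∀ x, f x - q * avg G f x = 0 := fun x => congrFun hf x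
    have h2 : ∀ x, (-f) x - q * avg G (-f) x = 0 := by
      intro x
      have := congrFun (map_neg L f) x
      rw [hf] at this
      simpa [L] using this
    have a := min_principle G hd hq0 hq f (fun x => (h1 x).ge)
    have b := min_principle G hd hq0 hq (-f) (fun x => (h2 x).ge)
    ext x
    have := a x
    have := b x
    simp only [Pi.neg_apply, Pi.zero_apply] at *
    linarith
  obtain ⟨f, hf⟩ := (LinearMap.injective_iff_surjective.mp hinj) (fun x => if x = y then 1 else 0)
  exact ⟨f, fun x => congrFun hf x⟩

lemma green_le [Nonempty V] (hd : ∀ v, 1 ≤ G.degree v) {q : ℝ} (hq0 : 0 ≤ q) (hq : q < 1)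
    (y : V) (f : V → ℝ) (hf : ∀ x, f x - q * avg G f x = if x = y then 1 else 0)
    (hf0 : ∀ x, 0 ≤ f x) : ∀ x, f x ≤ f y := by
  obtain ⟨z, hz⟩ := Finite.exists_max f
  by_cases hzy : z = y
  · subst hzy; exact hz
  have h1 : avg G f z ≤ f z := by
    have := avg_mono G (g := fun v => f z + 0 * f v) (f := f) (by simpa using hz) z
    rw [avg_affine G hd] at this
    linarith
  have h2 := hf z
  rw [if_neg hzy] at h2
  have : f z ≤ 0 := by nlinarith
  intro x
  exact ((hz x).trans this).trans (hf0 y)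

lemma energy (hd : ∀ v, 1 ≤ G.degree v) {q : ℝ}
    (y : V) (f : V → ℝ) (hf : ∀ x, f x - q * avg G f x = if x = y then 1 else 0) :
    (1 - q) * (∑ u, (G.degree u : ℝ) * f u ^ 2) +
      q / 4 * (∑ u, ∑ v, if G.Adj u v then (f u - f v) ^ 2 else 0) = G.degree y * f y := by
  have e1 : ∑ u, (G.degree u : ℝ) * f u * (f u - q * avg G f u) = G.degree y * f y := by
    simp_rw [hf]; simp
  have e2 : ∀ u, (G.degree u : ℝ) * f u * (f u - q * avg G f u) =
      (1 - q / 2) * ((G.degree u : ℝ) * f u ^ 2)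
        - q / 2 * ∑ v, (if G.Adj u v then f u * f v else 0) := by
    intro u
    have h := degree_mul_step G u (hd u) f
    have h' : ∑ v, (if G.Adj u v then f u * f v else 0) =
        f u * ∑ v, (if G.Adj u v then f v else 0) := by
      rw [Finset.mul_sum]
      exact Finset.sum_congr rfl fun v _ => by split_ifs <;> simp
    rw [h']
    unfold avg
    linear_combination (-q * f u) * h
  have row : ∀ u, ∑ v, (if G.Adj u v then f u ^ 2 else 0) = (G.degree u : ℝ) * f u ^ 2 := by
    intro u
    rw [← sum_adj_one, Finset.sum_mul]
    exact Finset.sum_congr rfl fun v _ => by split_ifs <;> simp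
  have col : ∑ u, ∑ v, (if G.Adj u v then f v ^ 2 else 0) = ∑ u, (G.degree u : ℝ) * f u ^ 2 := by
    rw [Finset.sum_comm]
    apply Finset.sum_congr rfl
    intro u _
    rw [← row]
    exact Finset.sum_congr rfl fun v _ => by simp [G.adj_comm]
  have e3 : (∑ u, ∑ v, if G.Adj u v then (f u - f v) ^ 2 else 0) =
      ∑ u, ∑ v, (if G.Adj u v then f u ^ 2 else 0) + ∑ u, ∑ v, (if G.Adj u v then f v ^ 2 else 0)
       - 2 * ∑ u, ∑ v, (if G.Adj u v then f u * f v else 0) := by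
    simp_rw [Finset.mul_sum, ← Finset.sum_add_distrib, ← Finset.sum_sub_distrib]
    refine Finset.sum_congr rfl fun u _ => Finset.sum_congr rfl fun v _ => ?_
    split_ifs <;> ring
  rw [col] at e3
  simp_rw [row] at e3
  simp_rw [e2] at e1
  rw [Finset.sum_sub_distrib, ← Finset.mul_sum, ← Finset.mul_sum] at e1
  rw [e3]
  linear_combination e1

lemma sum_add_sq (f : V → ℝ) :
    (∑ u, ∑ v, if G.Adj u v then (f u + f v) ^ 2 else 0) ≤
      4 * ∑ u, (G.degree u : ℝ) * f u ^ 2 := by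
  have row : ∀ u, ∑ v, (if G.Adj u v then f u ^ 2 else 0) = (G.degree u : ℝ) * f u ^ 2 := by
    intro u
    rw [← sum_adj_one, Finset.sum_mul]
    exact Finset.sum_congr rfl fun v _ => by split_ifs <;> simp
  have col : ∑ u, ∑ v, (if G.Adj u v then f v ^ 2 else 0) = ∑ u, (G.degree u : ℝ) * f u ^ 2 := by
    rw [Finset.sum_comm]
    apply Finset.sum_congr rfl
    intro u _
    rw [← row]
    exact Finset.sum_congr rfl fun v _ => by simp [G.adj_comm]
  have : (∑ u, ∑ v, if G.Adj u v then (f u + f v) ^ 2 else 0) ≤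
      2 * (∑ u, ∑ v, (if G.Adj u v then f u ^ 2 else 0)) +
      2 * ∑ u, ∑ v, (if G.Adj u v then f v ^ 2 else 0) := by
    simp_rw [Finset.mul_sum, ← Finset.sum_add_distrib]
    refine Finset.sum_le_sum fun u _ => Finset.sum_le_sum fun v _ => ?_
    split_ifs
    · nlinarith [sq_nonneg (f u - f v)]
    · simp
  rw [col] at this
  simp_rw [row] at this
  linarith

lemma walk_le (h : V → ℝ) {a b : V} (p : G.Walk a b) :
    h a - h b ≤ (p.darts.map fun d => max (h d.fst - h d.snd) 0).sum := by
  induction p with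
  | nil => simp
  | cons hadj p ih =>
    simp only [SimpleGraph.Walk.darts_cons, List.map_cons, List.sum_cons]
    rename_i u v w
    have := le_max_left (h u - h v) 0
    linarith

lemma diff_le (hG : G.Connected) (h : V → ℝ) (a b : V) :
    h a - h b ≤ (1 / 2) * ∑ u, ∑ v, if G.Adj u v then |h u - h v| else 0 := by
  obtain ⟨p, hp⟩ := (hG.preconnected a b).exists_isPath
  have h1 := walk_le G h p
  have nd : (p.darts.map (fun d => (d.fst, d.snd))).Nodup := by
    apply List.Nodup.map
    · intro d e hde
      ext
      · exact congrArg Prod.fst hde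
      · exact congrArg Prod.snd hde
    · exact List.Nodup.of_map _ hp.isTrail.edges_nodup
  have h2 : (p.darts.map fun d => max (h d.fst - h d.snd) 0).sum ≤
      ∑ w : V × V, if G.Adj w.1 w.2 then max (h w.1 - h w.2) 0 else 0 := by
    have : (p.darts.map fun d => max (h d.fst - h d.snd) 0).sum =
      ((p.darts.map (fun d => (d.fst, d.snd))).map fun w : V × V =>
        if G.Adj w.1 w.2 then max (h w.1 - h w.2) 0 else 0).sum := by
      rw [List.map_map]
      congr 1
      apply List.map_congr_left
      intro d _
      simp [d.adj]
    rw [this, ← List.sum_toFinset _ nd]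
    apply Finset.sum_le_sum_of_subset_of_nonneg (Finset.subset_univ _)
    intro w _ _
    split_ifs
    · exact le_max_right _ _
    · exact le_rfl
  rw [Fintype.sum_prod_type] at h2
  dsimp only at h2
  have h3 : (∑ u, ∑ v, if G.Adj u v then max (h u - h v) 0 else 0) =
      ∑ u, ∑ v, if G.Adj u v then max (h v - h u) 0 else 0 := by
    rw [Finset.sum_comm]
    refine Finset.sum_congr rfl fun u _ => Finset.sum_congr rfl fun v _ => ?_
    simp [G.adj_comm]
  have h4 : (∑ u, ∑ v, if G.Adj u v then |h u - h v| else 0) =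
      (∑ u, ∑ v, if G.Adj u v then max (h u - h v) 0 else 0) +
      ∑ u, ∑ v, if G.Adj u v then max (h v - h u) 0 else 0 := by
    simp_rw [← Finset.sum_add_distrib]
    refine Finset.sum_congr rfl fun u _ => Finset.sum_congr rfl fun v _ => ?_
    split_ifs
    · rcases le_total (h u) (h v) with hh | hh
      · rw [abs_of_nonpos (by linarith), max_eq_right (by linarith), max_eq_left (by linarith)]
        ring
      · rw [abs_of_nonneg (by linarith), max_eq_left (by linarith), max_eq_right (by linarith)]
        ring
    · simp
  linarith

lemma sq_diff_le (hG : G.Connected) (f : V → ℝ) (a b : V) {c : ℝ} (hc : 0 < c) :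
    f a ^ 2 - f b ^ 2 ≤
      c / 4 * (∑ u, ∑ v, if G.Adj u v then (f u - f v) ^ 2 else 0) +
        (1 / c) * ∑ u, (G.degree u : ℝ) * f u ^ 2 := by
  have h1 := diff_le G hG (fun v => f v ^ 2) a b
  have h2 := sum_add_sq G f
  have h3 : (∑ u, ∑ v, if G.Adj u v then |f u ^ 2 - f v ^ 2| else 0) ≤
      c / 2 * (∑ u, ∑ v, if G.Adj u v then (f u - f v) ^ 2 else 0) +
      (1 / c) / 2 * (∑ u, ∑ v, if G.Adj u v then (f u + f v) ^ 2 else 0) := by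
    simp_rw [Finset.mul_sum, ← Finset.sum_add_distrib]
    refine Finset.sum_le_sum fun u _ => Finset.sum_le_sum fun v _ => ?_
    split_ifs
    · have e : f u ^ 2 - f v ^ 2 = (f u - f v) * (f u + f v) := by ring
      rw [e, abs_mul, ← sq_abs (f u - f v), ← sq_abs (f u + f v)]
      generalize |f u - f v| = A
      generalize |f u + f v| = B
      have : c / 2 * A ^ 2 + 1 / c / 2 * B ^ 2 - A * B = (c * A - B) ^ 2 / (2 * c) := by
        field_simp
        ring
      have : 0 ≤ (c * A - B) ^ 2 / (2 * c) := by positivity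
      linarith
    · simp
  have h4 := mul_le_mul_of_nonneg_left h2 (by positivity : 0 ≤ 1 / c / 2)
  linarith

/-- Main Green function bound. -/
lemma green_bound [Nonempty V] (hG : G.Connected) (hd : ∀ v, 1 ≤ G.degree v) (y : V) (t : ℕ)
    (f : V → ℝ)
    (hf : ∀ x, f x - (((t : ℝ) + 1) / (t + 2)) * avg G f x = if x = y then 1 else 0)
    (hf0 : ∀ x, 0 ≤ f x) (hm : 0 < G.edgeFinset.card) :
    f y ≤ G.degree y * (Real.sqrt (t + 1) * ((t + 2) / (t + 1)) +
      (t + 2) / (2 * (G.edgeFinset.card : ℝ))) := by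
  set m : ℝ := (G.edgeFinset.card : ℝ) with hmdef
  have hm' : 0 < m := by rw [hmdef]; exact_mod_cast hm
  obtain ⟨z, hz⟩ := Finite.exists_min f
  have hR : 0 < Real.sqrt ((t : ℝ) + 1) := Real.sqrt_pos.mpr (by positivity)
  have hR2 : Real.sqrt ((t : ℝ) + 1) ^ 2 = t + 1 := Real.sq_sqrt (by positivity)
  set R := Real.sqrt ((t : ℝ) + 1) with hRdef
  have h1 := energy G hd y f hf
  have h2 := sq_diff_le G hG f y z hR
  set S := ∑ u, (G.degree u : ℝ) * f u ^ 2 with hS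
  set D := (∑ u, ∑ v, if G.Adj u v then (f u - f v) ^ 2 else 0) with hD
  have hD0 : 0 ≤ D := by
    refine Finset.sum_nonneg fun u _ => Finset.sum_nonneg fun v _ => ?_
    split_ifs <;> positivity
  have hdeg : ∑ u, (G.degree u : ℝ) = 2 * m := by
    rw [hmdef]
    exact_mod_cast G.sum_degrees_eq_twice_card_edges
  have h3 : 2 * m * f z ^ 2 ≤ S := by
    rw [← hdeg, Finset.sum_mul]
    refine Finset.sum_le_sum fun u _ => ?_
    have := hf0 z
    have := hz u
    gcongr
  have ht2 : (0 : ℝ) < t + 2 := by positivity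
  have ht1 : (0 : ℝ) < t + 1 := by positivity
  have h1' : S + (t + 1) / 4 * D = (t + 2) * (G.degree y * f y) := by
    rw [← h1]
    field_simp
    ring
  have h4 : R / 4 * D + 1 / R * S = (1 / R) * ((t + 2) * (G.degree y * f y)) := by
    rw [← h1', ← hR2]
    field_simp
    ring
  have h5 : 1 / R = R / (t + 1) := by rw [← hR2]; field_simp
  have h6 : f z ^ 2 ≤ (t + 2) * (G.degree y * f y) / (2 * m) := by
    rw [le_div_iff₀ (by positivity)]
    have : 0 ≤ ((t : ℝ) + 1) / 4 * D := by positivity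
    linarith
  rw [h4, h5] at h2
  have h7 : f y ^ 2 ≤ f y * (G.degree y * (R * ((t + 2) / (t + 1)) + (t + 2) / (2 * m))) := by
    have : f y * (G.degree y * (R * ((t + 2) / (t + 1)) + (t + 2) / (2 * m))) =
      R / (t + 1) * ((t + 2) * (G.degree y * f y)) + (t + 2) * (G.degree y * f y) / (2 * m) := by
      field_simp
    linarith
  rcases (hf0 y).eq_or_lt with h0 | h0
  · rw [← h0]; positivity
  · rw [sq] at h7
    exact le_of_mul_le_mul_left h7 h0

lemma law_nonneg (x : V) (t : ℕ) (f : Fin (t + 1) → V) : 0 ≤ lazyWalkLaw G x t f := by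
  unfold lazyWalkLaw
  apply mul_nonneg
  · split_ifs <;> norm_num
  · exact Finset.prod_nonneg fun i _ => lazyStep_nonneg G _ _

lemma pow_visits (a : ℝ) (y : V) {t : ℕ} (f : Fin (t + 1) → V) :
    a ^ visits y f = ∏ i, if f i = y then a else 1 := by
  unfold visits
  rw [Finset.prod_ite]
  simp

/-- Moment generating function. -/
noncomputable def mgf (a : ℝ) (y : V) (t : ℕ) (x : V) : ℝ :=
  lazyWalkExp G x t (fun f => a ^ visits y f)

lemma mgf_zero (a : ℝ) (x y : V) : mgf G a y 0 x = if x = y then a else 1 := by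
  unfold mgf lazyWalkExp lazyWalkLaw
  simp_rw [pow_visits]
  rw [← (Equiv.funUnique (Fin 1) V).symm.sum_comp, Finset.sum_eq_single x]
  · simp
  · intro b _ hb
    simp [hb]
  · simp

lemma mgf_succ (a : ℝ) (x y : V) (t : ℕ) :
    mgf G a y (t + 1) x = (if x = y then a else 1) * avg G (mgf G a y t) x := by
  unfold mgf lazyWalkExp avg lazyWalkLaw
  simp_rw [pow_visits]
  rw [← (Fin.consEquiv (fun _ : Fin (t + 2) => V)).sum_comp, Fintype.sum_prod_type]
  simp only [Fin.consEquiv_apply]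
  rw [Finset.sum_eq_single x]
  · simp_rw [Finset.mul_sum]
    rw [Finset.sum_comm]
    refine Finset.sum_congr rfl fun g _ => ?_
    rw [Finset.sum_eq_single (g 0)]
    · rw [Fin.prod_univ_succ (n := t), Fin.prod_univ_succ (n := t + 1)]
      simp only [Fin.cons_zero, Fin.cons_succ, Fin.castSucc_zero, ← Fin.succ_castSucc, if_true,
        one_mul]
      ring
    · intro b _ hb
      simp [hb.symm]
    · simp
  · intro b _ hb
    simp [hb]
  · simp

lemma mgf_le (hd : ∀ v, 1 ≤ G.degree v) {q s : ℝ} (hq0 : 0 < q) (hq : q < 1) (hs : 0 ≤ s)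
    (y : V) (t : ℕ) (f : V → ℝ) (hf : ∀ x, f x - q * avg G f x = if x = y then 1 else 0)
    (hf0 : ∀ x, 0 ≤ f x) (hM : ∀ x, 2 * s * ((q⁻¹) ^ t * f x) ≤ 1) :
    ∀ j, j ≤ t → ∀ x, mgf G (1 + s) y j x ≤ 1 + 2 * s * ((q⁻¹) ^ j * f x) := by
  have hqi : 1 ≤ q⁻¹ := (one_le_inv₀ hq0).mpr hq.le
  have havg : ∀ x, avg G f x = q⁻¹ * (f x - if x = y then 1 else 0) := by
    intro x
    rw [← hf x]
    field_simp
    ring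
  have hfy : ∀ x, (if x = y then (1 : ℝ) else 0) ≤ f x := by
    intro x
    rw [← hf x]
    have : 0 ≤ avg G f x := Finset.sum_nonneg fun v _ =>
      mul_nonneg (lazyStep_nonneg G x v) (hf0 v)
    nlinarith
  intro j
  induction j with
  | zero =>
    intro _ x
    rw [mgf_zero]
    have := hfy x
    split_ifs at * <;> simp <;> nlinarith
  | succ j ih =>
    intro hj x
    have ih' := ih (by omega)
    rw [mgf_succ]
    set A := avg G (mgf G (1 + s) y j) x with hA
    have hA1 : A ≤ 1 + 2 * s * (q⁻¹) ^ j * avg G f x := by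
      rw [hA, ← avg_affine G hd]
      apply avg_mono
      intro v
      have := ih' v
      linarith
    have hA2 : A ≤ 2 := by
      have : avg G (mgf G (1 + s) y j) x ≤ avg G (fun v => 2 + 0 * f v) x := by
        apply avg_mono
        intro v
        have h1 := ih' v
        have h2 := hM v
        have h3 : (q⁻¹) ^ j * f v ≤ (q⁻¹) ^ t * f v :=
          mul_le_mul_of_nonneg_right (pow_le_pow_right₀ hqi (by omega)) (hf0 v)
        have := mul_le_mul_of_nonneg_left h3 (by positivity : 0 ≤ 2 * s)
        linarith
      rw [avg_affine G hd] at this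
      linarith
    rw [havg] at hA1
    have hp : 1 ≤ (q⁻¹) ^ (j + 1) := one_le_pow₀ hqi
    have e : (q⁻¹) ^ (j + 1) = (q⁻¹) ^ j * q⁻¹ := pow_succ _ _
    have hA3 : A ≤ 1 + 2 * s * ((q⁻¹) ^ (j + 1) * (f x - if x = y then 1 else 0)) := by
      rw [e]; linarith
    generalize (q⁻¹) ^ (j + 1) = Q at *
    split_ifs at *
    · have h1 : s * A ≤ s * 2 := mul_le_mul_of_nonneg_left hA2 hs
      have h2 : s * 1 ≤ s * Q := mul_le_mul_of_nonneg_left hp hs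
      linarith
    · linarith

lemma markov (x y : V) (t : ℕ) {a B c θ : ℝ} (hB : 0 < B) (ha : 0 ≤ a)
    (h : ∀ N : ℕ, θ ≤ N → B ≤ a ^ N) (hc : mgf G a y t x ≤ c) :
    lazyWalkPr G x t {f | θ ≤ (visits y f : ℝ)} ≤ c / B := by
  rw [le_div_iff₀ hB]
  refine le_trans ?_ hc
  unfold lazyWalkPr mgf lazyWalkExp
  rw [Finset.sum_mul]
  refine Finset.sum_le_sum fun f _ => ?_
  have h0 := law_nonneg G x t f
  by_cases hf : f ∈ {f : Fin (t + 1) → V | θ ≤ (visits y f : ℝ)}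
  · rw [Set.indicator_of_mem hf]
    exact mul_le_mul_of_nonneg_left (h _ hf) h0
  · rw [Set.indicator_of_notMem hf]
    have : 0 ≤ a ^ visits y f := by positivity
    nlinarith

lemma inv_pow_le (t : ℕ) : ((((t : ℝ) + 1) / (t + 2))⁻¹) ^ t ≤ 2.7183 := by
  have h1 : ((((t : ℝ) + 1) / (t + 2))⁻¹) = 1 / (t + 1) + 1 := by
    field_simp
    ring
  have h2 : ((((t : ℝ) + 1) / (t + 2))⁻¹) ≤ Real.exp (1 / (t + 1)) := by
    rw [h1]; exact Real.add_one_le_exp _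
  calc ((((t : ℝ) + 1) / (t + 2))⁻¹) ^ t ≤ (Real.exp (1 / (t + 1))) ^ t := by
        apply pow_le_pow_left₀ (by positivity) h2
    _ = Real.exp (t * (1 / (t + 1))) := by rw [← Real.exp_nat_mul]
    _ ≤ Real.exp 1 := by
        apply Real.exp_le_exp.mpr
        rw [mul_one_div, div_le_one (by positivity)]
        linarith
    _ ≤ 2.7183 := by
        have := Real.exp_one_lt_d9
        norm_num at this ⊢
        linarith

lemma pow_lower {k n : ℝ} (hk : 1 ≤ k) (hn : 2 ≤ n) (N : ℕ)
    (hN : 3 * k * Real.logb 2 n ≤ N) : 2 * n ^ 2 ≤ (1 + 1 / k) ^ N := by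
  have hk0 : 0 < k := by linarith
  have h1 : (2 : ℝ) ≤ (1 + 1 / k) ^ k := by
    have := one_add_mul_self_le_rpow_one_add (s := 1 / k) (p := k) (by
      have : 0 ≤ 1 / k := by positivity
      linarith) hk
    rw [mul_one_div_cancel hk0.ne'] at this
    linarith
  have hb : (1 : ℝ) ≤ 1 + 1 / k := by
    have : 0 ≤ 1 / k := by positivity
    linarith
  have hL : 0 ≤ Real.logb 2 n := Real.logb_nonneg (by norm_num) (by linarith)
  calc 2 * n ^ 2 ≤ n ^ 3 := by nlinarith [sq_nonneg n]
    _ = ((2 : ℝ) ^ Real.logb 2 n) ^ 3 := by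
        rw [Real.rpow_logb (by norm_num) (by norm_num) (by linarith)]
    _ = (2 : ℝ) ^ (Real.logb 2 n * 3) := by
        rw [Real.rpow_mul (by norm_num)]; norm_cast
    _ ≤ ((1 + 1 / k) ^ k) ^ (Real.logb 2 n * 3) := by
        apply Real.rpow_le_rpow (by norm_num) h1 (by positivity)
    _ = (1 + 1 / k) ^ (k * (Real.logb 2 n * 3)) := by
        rw [← Real.rpow_mul (by linarith)]
    _ ≤ (1 + 1 / k) ^ (N : ℝ) := by
        apply Real.rpow_le_rpow_of_exponent_le hb
        linarith
    _ = (1 + 1 / k) ^ N := Real.rpow_natCast _ _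

end Helpers

/-- `Pr(N_t^x(y) ≥ 24·d(y)·√(t+1)·log₂ n) ≤ 1/n²` for all `t ≤ β·m²`,
where `n ≥ 2` is the number of vertices. -/
theorem statement_4 :
    ∃ β : ℝ, 0 < β ∧
      ∀ (V : Type) [Fintype V] [DecidableEq V] (G : SimpleGraph V) [DecidableRel G.Adj],
        2 ≤ Fintype.card V →
        G.Connected → (∀ v : V, 1 ≤ G.degree v) →
        ∀ x y : V, ∀ t : ℕ,
          (t : ℝ) ≤ β * (G.edgeFinset.card : ℝ) ^ 2 →
          lazyWalkPr G x t
              {f | 24 * (G.degree y : ℝ) * Real.sqrt (t + 1) *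
                  Real.logb 2 (Fintype.card V) ≤ (visits y f : ℝ)} ≤
            1 / (Fintype.card V : ℝ) ^ 2 := by
  refine ⟨1 / 200, by norm_num, ?_⟩
  intro V _ _ G _ hn hG hd x y t ht
  have hne : Nonempty V := ⟨x⟩
  have hn' : (2 : ℝ) ≤ Fintype.card V := by exact_mod_cast hn
  have hL : 1 ≤ Real.logb 2 (Fintype.card V) := by
    rw [Real.le_logb_iff_rpow_le (by norm_num) (by linarith)]
    simpa using hn'
  have hdy : (1 : ℝ) ≤ G.degree y := by exact_mod_cast hd y
  have hR : 0 < Real.sqrt ((t : ℝ) + 1) := Real.sqrt_pos.mpr (by positivity)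
  have hR2 : Real.sqrt ((t : ℝ) + 1) ^ 2 = t + 1 := Real.sq_sqrt (by positivity)
  set R := Real.sqrt ((t : ℝ) + 1) with hRdef
  set L := Real.logb 2 (Fintype.card V : ℝ) with hLdef
  have hth : 24 * R ≤ 24 * (G.degree y : ℝ) * R * L := by
    have h1 : R * 1 ≤ R * G.degree y := mul_le_mul_of_nonneg_left hdy hR.le
    have h2 : (R * G.degree y) * 1 ≤ (R * G.degree y) * L :=
      mul_le_mul_of_nonneg_left hL (by positivity)
    linarith
  by_cases hbig : R < 24
  · have hempty : {f : Fin (t + 1) → V | 24 * (G.degree y : ℝ) * R * L ≤ (visits y f : ℝ)} = ∅ := by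
      ext f
      simp only [Set.mem_ofPred_eq, Set.mem_empty_iff_false, iff_false, not_le]
      have hv : (visits y f : ℝ) ≤ t + 1 := by
        have : visits y f ≤ t + 1 := by
          unfold visits
          exact (Finset.card_le_univ _).trans (by simp)
        exact_mod_cast this
      nlinarith
    rw [hempty]
    unfold lazyWalkPr
    simp only [Set.indicator_empty, Finset.sum_const_zero]
    positivity
  push Not at hbig
  have htbig : (575 : ℝ) ≤ t := by nlinarith
  set m : ℝ := (G.edgeFinset.card : ℝ) with hm
  have hm0 : 0 ≤ m := by positivity
  have hmR : 10 * R ≤ m := by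
    apply le_of_sq_le_sq _ hm0
    nlinarith
  have hmpos : 0 < m := by linarith
  have hmpos' : 0 < G.edgeFinset.card := by
    rw [hm] at hmpos
    exact_mod_cast hmpos
  set q : ℝ := ((t : ℝ) + 1) / (t + 2) with hqdef
  have hq0 : 0 < q := by positivity
  have hq1 : q < 1 := by
    rw [hqdef, div_lt_one (by positivity)]
    linarith
  obtain ⟨f, hf⟩ := exists_green G hd hq0.le hq1 y
  have hf0 : ∀ x, 0 ≤ f x := min_principle G hd hq0.le hq1 f (by
    intro x
    rw [hf x]
    split_ifs <;> norm_num)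
  have hmax := green_le G hd hq0.le hq1 y f hf hf0
  have hF := green_bound G hG hd y t f hf hf0 hmpos'
  have hF2 : f y ≤ G.degree y * (R * 1.35) := by
    refine hF.trans (mul_le_mul_of_nonneg_left ?_ (by positivity))
    have h1 : ((t : ℝ) + 2) / (t + 1) ≤ 1.25 := by
      rw [div_le_iff₀ (by positivity)]
      linarith
    have h2 : ((t : ℝ) + 2) / (2 * m) ≤ 0.1 * R := by
      rw [div_le_iff₀ (by positivity)]
      nlinarith
    have h3 := mul_le_mul_of_nonneg_left h1 hR.le
    linarith
  have hk : 1 ≤ 8 * (G.degree y : ℝ) * R := by nlinarith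
  have hM : ∀ x, 2 * (1 / (8 * (G.degree y : ℝ) * R)) * ((q⁻¹) ^ t * f x) ≤ 1 := by
    intro x
    have h1 : (q⁻¹) ^ t * f x ≤ 2.7183 * (G.degree y * (R * 1.35)) :=
      mul_le_mul (inv_pow_le t) ((hmax x).trans hF2) (hf0 x) (by norm_num)
    have h0 : 0 < (G.degree y : ℝ) * R := by positivity
    rw [mul_one_div, div_mul_eq_mul_div, div_le_one (by positivity)]
    nlinarith
  have hmgf : mgf G (1 + 1 / (8 * (G.degree y : ℝ) * R)) y t x ≤ 2 := by
    have := mgf_le G hd hq0 hq1 (by positivity) y t f hf hf0 hM t le_rfl x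
    have := hM x
    linarith
  have key := markov G x y t (a := 1 + 1 / (8 * (G.degree y : ℝ) * R))
    (B := 2 * (Fintype.card V : ℝ) ^ 2) (c := 2) (θ := 24 * (G.degree y : ℝ) * R * L)
    (by positivity) (by positivity) (by
      intro N hN
      apply pow_lower hk hn'
      rw [← hLdef]
      linarith) hmgf
  refine key.trans (le_of_eq ?_)
  field_simp
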